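/- For every subdivided star S, the Grundy value of the 0.33 game on S equals the Grundy value of the 0.33 game on the subdivided bistar S •1• S_{1,1}, i.e., on the tree obtained from S by joining its central vertex by an edge to the central vertex of a disjoint star S_{1,1} (a claw on 3 vertices: a center with two pendant leaves). -/

import Mathlib

open SimpleGraph

/-- The minimum excludant of a set of naturals. -/
noncomputable def mex (A : Set ℕ) : ℕ := sInf {n : ℕ | n ∉ A}

/-- The connected component (as a vertex set) of `x` in the subgraph of `G`
induced on the vertex set `s`. -/
def compOf {V : Type} (G : SimpleGraph V) (s : Set V) (x : V) : Set V :=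
  {v | ∃ (hx : x ∈ s) (hv : v ∈ s), (G.induce s).Reachable ⟨x, hx⟩ ⟨v, hv⟩}

/-- A legal move of the 0.33 game on the graph `G`, from the position (vertex set) `s`
to the position `t`: one removes either a single vertex of `s`, or two vertices of `s`
that are adjacent in `G`, and the removed set may not disconnect the connected component
`H` (of the subgraph induced on `s`) containing it: `H` minus the removed set must be
connected or empty. -/
def ValidMove {V : Type} [DecidableEq V] (G : SimpleGraph V) (s t : Finset V) : Prop :=
  t ⊆ s ∧
  ((∃ x ∈ s, s \ t = {x}) ∨ (∃ x ∈ s, ∃ y ∈ s, G.Adj x y ∧ s \ t = {x, y})) ∧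
  ∀ x ∈ s \ t,
    (compOf G (↑s) x \ (↑(s \ t) : Set V) = ∅ ∨
     (G.induce (compOf G (↑s) x \ (↑(s \ t) : Set V))).Connected)

theorem ValidMove.card_lt {V : Type} [DecidableEq V] {G : SimpleGraph V} {s t : Finset V}
    (h : ValidMove G s t) : t.card < s.card := by
  apply Finset.card_lt_card
  rw [Finset.ssubset_iff_of_subset h.1]
  rcases h.2.1 with ⟨x, hx, he⟩ | ⟨x, hx, y, hy, _, he⟩
  · refine ⟨x, hx, fun hxt => ?_⟩
    have hmem : x ∈ s \ t := by rw [he]; exact Finset.mem_singleton_self x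
    exact (Finset.mem_sdiff.mp hmem).2 hxt
  · refine ⟨x, hx, fun hxt => ?_⟩
    have hmem : x ∈ s \ t := by rw [he]; simp
    exact (Finset.mem_sdiff.mp hmem).2 hxt

/-- The Grundy value of the 0.33 game on the graph `G` played on the vertex set `s`. -/
noncomputable def grundy {V : Type} [DecidableEq V] (G : SimpleGraph V) (s : Finset V) : ℕ :=
  mex {n : ℕ | ∃ t : {t : Finset V // ValidMove G s t}, grundy G t.1 = n}
termination_by s.card
decreasing_by exact t.2.card_lt

/-! ### Concrete graphs

`pathG` played on `Finset.range n` is the path `P_n`;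
`cycleG n` played on `Finset.range n` is the cycle `C_n`.

Subdivided stars and bistars are encoded on vertex type `ℕ × ℕ`.
A subdivided star is given by the list `L` of the numbers of vertices of its arms
(`some L`), or is the empty graph (`none`).
In the bistar `S₁ •m• S₂`, the center of `S₁` is `(0,0)`, the middle path consists of
`(1,1), …, (1,m)` where `(1,m)` is the center of `S₂` (when `m = 0` the two centers are
identified to `(0,0)`), the `i`-th arm of `S₁` consists of `(2i+2, 1), …, (2i+2, ℓᵢ)`,
and the `i`-th arm of `S₂` consists of `(2i+3, 1), …, (2i+3, ℓ'ᵢ)`.  If `S₂` is the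
empty graph, its center `(1,m)` is removed (so `S₁` just gets an extra arm with `m-1`
vertices), and similarly for `S₁`. -/

def pathG : SimpleGraph ℕ := SimpleGraph.fromRel (fun u v => v = u + 1)

def cycleG (n : ℕ) : SimpleGraph ℕ := SimpleGraph.fromRel (fun u v => v % n = (u + 1) % n)

def bistarG (m : ℕ) : SimpleGraph (ℕ × ℕ) :=
  SimpleGraph.fromRel (fun u v =>
    (u = (0, 0) ∧ v = (1, 1)) ∨
    (u.1 = 1 ∧ v.1 = 1 ∧ v.2 = u.2 + 1) ∨
    (u = (0, 0) ∧ 2 ≤ v.1 ∧ v.1 % 2 = 0 ∧ v.2 = 1) ∨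
    (u = (if m = 0 then ((0 : ℕ), (0 : ℕ)) else (1, m)) ∧ 3 ≤ v.1 ∧ v.1 % 2 = 1 ∧ v.2 = 1) ∨
    (u.1 = v.1 ∧ 2 ≤ u.1 ∧ v.2 = u.2 + 1))

def armVerts (base : ℕ) (L : List ℕ) : Finset (ℕ × ℕ) :=
  (Finset.range L.length).biUnion
    (fun i => (Finset.range (L.getD i 0)).image (fun j => (2 * i + base, j + 1)))

def bistarVerts (S1 S2 : Option (List ℕ)) (m : ℕ) : Finset (ℕ × ℕ) :=
  (match S1 with
   | none => (∅ : Finset (ℕ × ℕ))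
   | some L => insert ((0 : ℕ), (0 : ℕ)) (armVerts 2 L)) ∪
  (match S2 with
   | none => (Finset.range (m - 1)).image (fun p => ((1 : ℕ), p + 1))
   | some L => ((Finset.range m).image (fun p => ((1 : ℕ), p + 1))) ∪ armVerts 3 L)

/-- Grundy value of the 0.33 game on the subdivided bistar `S₁ •m• S₂`
(where `S₁`, `S₂` are subdivided stars or the empty graph). -/
noncomputable def bistarGrundyO (S1 S2 : Option (List ℕ)) (m : ℕ) : ℕ :=
  grundy (bistarG m) (bistarVerts S1 S2 m)

/-- Grundy value of the 0.33 game on the subdivided bistar `S_{L₁} •m• S_{L₂}`. -/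
noncomputable def bistarGrundy (L1 L2 : List ℕ) (m : ℕ) : ℕ :=
  bistarGrundyO (some L1) (some L2) m

/-- Grundy value of the 0.33 game on the subdivided star `S_L`. -/
noncomputable def starGrundy (L : List ℕ) : ℕ := bistarGrundy L [] 0

/-- Grundy value of the 0.33 game on a subdivided star or the empty graph. -/
noncomputable def starGrundyO (S : Option (List ℕ)) : ℕ := bistarGrundyO S (some []) 0

/-- Every arm of the subdivided star has at least one vertex. -/
def armsPos (L : List ℕ) : Prop := ∀ ℓ ∈ L, 1 ≤ ℓ

/-! ### Minimum excludants and Grundy values -/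

theorem mex_notMem {A : Set ℕ} (hA : A.Finite) : mex A ∉ A :=
  Nat.sInf_mem (s := {n : ℕ | n ∉ A}) hA.infinite_compl.nonempty

theorem mem_of_lt_mex {A : Set ℕ} {m : ℕ} (hm : m < mex A) : m ∈ A :=
  not_not.mp (Nat.notMem_of_lt_sInf (s := {n : ℕ | n ∉ A}) hm)

theorem mex_eq_of {A : Set ℕ} {n : ℕ} (hn : n ∉ A) (hlt : ∀ m < n, m ∈ A) : mex A = n := by
  refine le_antisymm (Nat.sInf_le hn) ?_
  by_contra! h
  exact Nat.sInf_mem (s := {n : ℕ | n ∉ A}) ⟨n, hn⟩ (hlt _ h)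

/-! ### Connected positions -/

section Linked

variable {V W : Type} {G : SimpleGraph V} {H : SimpleGraph W}

/-- `s` induces a connected or empty subgraph: a nonempty subset of `s` without edges to its
complement in `s` is all of `s`. -/
def Linked (G : SimpleGraph V) (s : Set V) : Prop :=
  ∀ U : Set V, (∃ x ∈ s, x ∈ U) → (∀ x ∈ s, x ∈ U → ∀ y ∈ s, G.Adj x y → y ∈ U) → s ⊆ U

theorem Linked.reachable {s : Set V} (hs : Linked G s) (x y : s) :
    (G.induce s).Reachable x y := by
  have := hs {v | ∃ hv : v ∈ s, (G.induce s).Reachable x ⟨v, hv⟩} ⟨x, x.2, x.2, Reachable.rfl⟩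
    (fun u hu ⟨_, h⟩ v hv huv => ⟨hv, h.trans
      (Adj.reachable (G := G.induce s) (u := ⟨u, hu⟩) (v := ⟨v, hv⟩) huv)⟩)
  exact (this y.2).2

theorem linked_of_preconnected {s : Set V} (hs : (G.induce s).Preconnected) : Linked G s := by
  rintro U ⟨x, hx, hxU⟩ hU y hy
  obtain ⟨p⟩ := hs ⟨x, hx⟩ ⟨y, hy⟩
  have key : ∀ u v : s, (G.induce s).Walk u v → u.1 ∈ U → v.1 ∈ U := by
    intro u v p
    induction p with
    | nil => exact id
    | cons h _ ih => exact fun hu => ih (hU _ (Subtype.prop _) hu _ (Subtype.prop _) h)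
  exact key _ _ p hxU

theorem linked_iff {s : Set V} : Linked G s ↔ s = ∅ ∨ (G.induce s).Connected := by
  constructor
  · intro h
    rcases s.eq_empty_or_nonempty with he | hne
    · exact Or.inl he
    · have := hne.to_subtype
      exact Or.inr ⟨h.reachable⟩
  · rintro (rfl | h)
    · rintro U ⟨x, hx, _⟩
      exact hx.elim
    · exact linked_of_preconnected h.preconnected

theorem Linked.compOf_eq {s : Set V} (hs : Linked G s) {x : V} (hx : x ∈ s) :
    compOf G s x = s := by
  ext v
  exact ⟨fun ⟨_, hv, _⟩ => hv, fun hv => ⟨hx, hv, hs.reachable _ _⟩⟩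

theorem Linked.insert {s : Set V} (hs : Linked G s) {x y : V} (hy : y ∈ s) (h : G.Adj y x) :
    Linked G (insert x s) := by
  intro U hne hU
  have hyU : y ∈ U := by
    obtain ⟨z, rfl | hz, hzU⟩ := hne
    · exact hU z (.inl rfl) hzU y (.inr hy) h.symm
    · exact hs U ⟨z, hz, hzU⟩
        (fun a ha haU b hb hab => hU a (.inr ha) haU b (.inr hb) hab) hy
  have hsU : s ⊆ U := hs U ⟨y, hy, hyU⟩
    (fun a ha haU b hb hab => hU a (.inr ha) haU b (.inr hb) hab)
  exact Set.insert_subset (hU y (.inr hy) hyU x (.inl rfl) h) hsU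

theorem linked_singleton (G : SimpleGraph V) (x : V) : Linked G {x} := by
  rintro U ⟨y, rfl, hy⟩ _ z rfl
  exact hy

theorem linked_empty (G : SimpleGraph V) : Linked G ∅ := linked_iff.mpr (.inl rfl)

theorem linked_image_iff {φ : V → W} {s : Set V} (hφ : Set.InjOn φ s)
    (hadj : ∀ x ∈ s, ∀ y ∈ s, (G.Adj x y ↔ H.Adj (φ x) (φ y))) :
    Linked H (φ '' s) ↔ Linked G s := by
  constructor
  · rintro h U ⟨x, hx, hxU⟩ hU y hy
    have := h (φ '' (U ∩ s)) ⟨φ x, ⟨x, hx, rfl⟩, x, ⟨hxU, hx⟩, rfl⟩ (by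
      rintro _ - ⟨u, ⟨huU, hu⟩, rfl⟩ _ ⟨v, hv, rfl⟩ huv
      exact ⟨v, ⟨hU u hu huU v hv ((hadj u hu v hv).mpr huv), hv⟩, rfl⟩)
    obtain ⟨z, ⟨hzU, hz⟩, he⟩ := this ⟨y, hy, rfl⟩
    rwa [← hφ hz hy he]
  · rintro h U ⟨_, ⟨x, hx, rfl⟩, hxU⟩ hU _ ⟨y, hy, rfl⟩
    exact h (φ ⁻¹' U) ⟨x, hx, hxU⟩ (fun u hu huU v hv huv =>
      hU _ ⟨u, hu, rfl⟩ huU _ ⟨v, hv, rfl⟩ ((hadj u hu v hv).mp huv)) hy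

end Linked

/-! ### Moves between connected positions -/

section Game

variable {V W : Type} [DecidableEq V] [DecidableEq W] {G : SimpleGraph V} {H : SimpleGraph W}

theorem grundy_eq_mex (G : SimpleGraph V) (s : Finset V) :
    grundy G s = mex {n : ℕ | ∃ t, ValidMove G s t ∧ grundy G t = n} := by
  rw [grundy]
  congr 1
  ext n
  simp

theorem grundy_ne_of_validMove {s t : Finset V} (h : ValidMove G s t) :
    grundy G t ≠ grundy G s := by
  intro he
  have hfin : {n : ℕ | ∃ t, ValidMove G s t ∧ grundy G t = n}.Finite := by
    refine ((s.powerset.image (grundy G)).finite_toSet).subset ?_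
    rintro n ⟨t, ht, rfl⟩
    simp only [Finset.coe_image, Set.mem_image, Finset.mem_coe, Finset.mem_powerset]
    exact ⟨t, ht.1, rfl⟩
  refine mex_notMem hfin ?_
  rw [← grundy_eq_mex]
  exact ⟨t, h, he⟩

theorem exists_validMove_of_lt_grundy {s : Finset V} {m : ℕ} (h : m < grundy G s) :
    ∃ t, ValidMove G s t ∧ grundy G t = m := by
  rw [grundy_eq_mex] at h
  exact mem_of_lt_mex h

theorem grundy_eq_of {s : Finset V} {n : ℕ} (hne : ∀ t, ValidMove G s t → grundy G t ≠ n)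
    (hlt : ∀ m < n, ∃ t, ValidMove G s t ∧ grundy G t = m) : grundy G s = n := by
  rw [grundy_eq_mex]
  exact mex_eq_of (fun ⟨t, ht, he⟩ => hne t ht he) hlt

/-- The legal moves from a connected position. -/
def LinkedMove (G : SimpleGraph V) (s t : Finset V) : Prop :=
  t ⊆ s ∧ (∃ x ∈ s, ∃ y ∈ s, (x = y ∨ G.Adj x y) ∧ s \ t = {x, y}) ∧ Linked G (t : Set V)

theorem validMove_iff {s t : Finset V} (hs : Linked G (s : Set V)) :
    ValidMove G s t ↔ LinkedMove G s t := by
  unfold ValidMove LinkedMove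
  refine and_congr_right fun hts => ?_
  have hrem : ((∃ x ∈ s, s \ t = {x}) ∨ ∃ x ∈ s, ∃ y ∈ s, G.Adj x y ∧ s \ t = {x, y}) ↔
      ∃ x ∈ s, ∃ y ∈ s, (x = y ∨ G.Adj x y) ∧ s \ t = {x, y} := by
    constructor
    · rintro (⟨x, hx, h⟩ | ⟨x, hx, y, hy, hxy, h⟩)
      · exact ⟨x, hx, x, hx, .inl rfl, by simpa using h⟩
      · exact ⟨x, hx, y, hy, .inr hxy, h⟩
    · rintro ⟨x, hx, y, hy, rfl | hxy, h⟩
      · exact .inl ⟨x, hx, by simpa using h⟩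
      · exact .inr ⟨x, hx, y, hy, hxy, h⟩
  rw [hrem]
  refine and_congr_right fun ⟨x, hx, y, _, _, he⟩ => ?_
  have hx' : x ∈ s \ t := by simp [he]
  have hcomp : ∀ z ∈ s \ t, compOf G (↑s) z \ (↑(s \ t) : Set V) = ↑t := by
    intro z hz
    rw [hs.compOf_eq (Finset.mem_sdiff.mp hz).1, ← Finset.coe_sdiff, Finset.sdiff_sdiff_eq_self hts]
  constructor
  · intro h
    have := h x hx'
    rw [hcomp x hx'] at this
    exact linked_iff.mpr this
  · intro h z hz
    rw [hcomp z hz]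
    exact linked_iff.mp h

theorem LinkedMove.card_lt {s t : Finset V} (h : LinkedMove G s t) : t.card < s.card := by
  obtain ⟨hts, ⟨x, hx, y, _, _, he⟩, _⟩ := h
  refine Finset.card_lt_card (Finset.ssubset_iff_of_subset hts |>.mpr ⟨x, hx, ?_⟩)
  have : x ∈ s \ t := by simp [he]
  exact (Finset.mem_sdiff.mp this).2

theorem LinkedMove.eq_or_adj {s t : Finset V} (h : LinkedMove G s t) {u v : V}
    (hu : u ∈ s) (hut : u ∉ t) (hv : v ∈ s) (hvt : v ∉ t) : u = v ∨ G.Adj u v := by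
  obtain ⟨_, ⟨x, _, y, _, hxy, he⟩, _⟩ := h
  have hu' : u ∈ s \ t := Finset.mem_sdiff.mpr ⟨hu, hut⟩
  have hv' : v ∈ s \ t := Finset.mem_sdiff.mpr ⟨hv, hvt⟩
  simp only [he, Finset.mem_insert, Finset.mem_singleton] at hu' hv'
  rcases hu' with rfl | rfl <;> rcases hv' with rfl | rfl
  · exact .inl rfl
  · exact hxy
  · exact hxy.imp Eq.symm SimpleGraph.Adj.symm
  · exact .inl rfl

theorem grundy_empty (G : SimpleGraph V) : grundy G ∅ = 0 := by
  refine grundy_eq_of (fun t ht => ?_) (by simp)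
  simpa using ht.card_lt

theorem grundy_image {φ : V → W} {s : Finset V} (hs : Linked G (s : Set V))
    (hφ : Set.InjOn φ s) (hadj : ∀ x ∈ s, ∀ y ∈ s, (G.Adj x y ↔ H.Adj (φ x) (φ y))) :
    grundy H (s.image φ) = grundy G s := by
  induction hn : s.card using Nat.strong_induction_on generalizing s with
  | _ n ih =>
  have hlink : ∀ t ⊆ s, (Linked H (t.image φ : Set W) ↔ Linked G (t : Set V)) := fun t ht => by
    rw [Finset.coe_image]
    exact linked_image_iff (hφ.mono (Finset.coe_subset.mpr ht))
      fun x hx y hy => hadj x (ht hx) y (ht hy)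
  have hs' : Linked H (s.image φ : Set W) := (hlink s subset_rfl).mpr hs
  have hsd : ∀ t ⊆ s, s.image φ \ t.image φ = (s \ t).image φ := fun t ht => by
    refine (Finset.image_sdiff_of_injOn ?_ ht).symm
    exact hφ
  have hto : ∀ t, LinkedMove G s t → LinkedMove H (s.image φ) (t.image φ) := by
    rintro t ⟨hts, ⟨x, hx, y, hy, hxy, he⟩, ht⟩
    refine ⟨Finset.image_subset_image hts, ⟨φ x, Finset.mem_image_of_mem _ hx, φ y,
      Finset.mem_image_of_mem _ hy, hxy.imp (congrArg φ) (hadj x hx y hy).mp, ?_⟩,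
      (hlink t hts).mpr ht⟩
    rw [hsd t hts, he, Finset.image_insert, Finset.image_singleton]
  have hfrom : ∀ t', LinkedMove H (s.image φ) t' → ∃ t, LinkedMove G s t ∧ t.image φ = t' := by
    rintro t' ⟨hts, ⟨x', hx', y', hy', hxy, he⟩, ht⟩
    obtain ⟨t, hts', rfl⟩ := Finset.subset_image_iff.mp hts
    replace hts : t ⊆ s := Finset.coe_subset.mp hts'
    obtain ⟨x, hx, rfl⟩ := Finset.mem_image.mp hx'
    obtain ⟨y, hy, rfl⟩ := Finset.mem_image.mp hy'
    refine ⟨t, ⟨hts, ⟨x, hx, y, hy, hxy.imp (hφ hx hy ·) (hadj x hx y hy).mpr, ?_⟩,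
      (hlink t hts).mp ht⟩, rfl⟩
    rw [hsd t hts] at he
    ext v
    constructor
    · intro hv
      have := he ▸ Finset.mem_image_of_mem φ hv
      have hvs := (Finset.mem_sdiff.mp hv).1
      simp only [Finset.mem_insert, Finset.mem_singleton] at this ⊢
      exact this.imp (hφ hvs hx ·) (hφ hvs hy ·)
    · intro hv
      have hvs : v ∈ s := by
        simp only [Finset.mem_insert, Finset.mem_singleton] at hv
        rcases hv with rfl | rfl <;> assumption
      have : φ v ∈ (s \ t).image φ := by
        rw [he]
        simp only [Finset.mem_insert, Finset.mem_singleton] at hv ⊢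
        exact hv.imp (congrArg φ) (congrArg φ)
      obtain ⟨w, hw, hwv⟩ := Finset.mem_image.mp this
      rwa [← hφ (Finset.mem_sdiff.mp hw).1 hvs hwv]
  have hval : ∀ t, LinkedMove G s t → grundy H (t.image φ) = grundy G t := fun t ht =>
    ih _ (hn ▸ ht.card_lt) ht.2.2 (hφ.mono (Finset.coe_subset.mpr ht.1))
      (fun x hx y hy => hadj x (ht.1 hx) y (ht.1 hy)) rfl
  refine grundy_eq_of (fun t' ht' => ?_) (fun m hm => ?_)
  · obtain ⟨t, ht, rfl⟩ := hfrom t' ((validMove_iff hs').mp ht')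
    rw [hval t ht]
    exact grundy_ne_of_validMove ((validMove_iff hs).mpr ht)
  · obtain ⟨t, ht, rfl⟩ := exists_validMove_of_lt_grundy hm
    have ht := (validMove_iff hs).mp ht
    exact ⟨_, (validMove_iff hs').mpr (hto t ht), hval t ht⟩

theorem grundy_ne_zero_of_card_le_two {s : Finset V} (hs : Linked G (s : Set V))
    (hne : s.Nonempty) (hcard : s.card ≤ 2) : grundy G s ≠ 0 := by
  have hmove : LinkedMove G s ∅ := by
    refine ⟨Finset.empty_subset _, ?_, by simpa using linked_empty G⟩
    rw [Finset.sdiff_empty]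
    obtain ⟨x, hx⟩ := hne
    by_cases h : ∃ y ∈ s, y ≠ x
    · obtain ⟨y, hy, hyx⟩ := h
      have hsxy : s = {x, y} := by
        refine (Finset.eq_of_subset_of_card_le ?_ ?_).symm
        · simp [Finset.insert_subset_iff, hx, hy]
        · rwa [Finset.card_pair hyx.symm]
      refine ⟨x, hx, y, hy, .inr ?_, hsxy⟩
      by_contra hxy
      refine hyx (hs {x} ⟨x, hx, rfl⟩ ?_ hy)
      rintro u - rfl v hv huv
      rw [hsxy] at hv
      simp only [Finset.coe_insert, Finset.coe_singleton, Set.mem_insert_iff,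
        Set.mem_singleton_iff] at hv
      rcases hv with rfl | rfl
      · rfl
      · exact absurd huv hxy
    · push Not at h
      exact ⟨x, hx, x, hx, .inl rfl, by ext v; simpa using ⟨h v, fun hv => hv ▸ hx⟩⟩
  have := grundy_ne_of_validMove ((validMove_iff hs).mpr hmove)
  rw [grundy_empty] at this
  exact this.symm

theorem grundy_eq_zero_of_card_eq_three {s : Finset V} (hs : Linked G (s : Set V))
    (hcard : s.card = 3) : grundy G s = 0 := by
  refine grundy_eq_of (fun t ht => ?_) (by simp)
  have ht := (validMove_iff hs).mp ht
  have hlt := ht.card_lt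
  refine grundy_ne_zero_of_card_le_two ht.2.2 ?_ (by omega)
  rw [Finset.nonempty_iff_ne_empty]
  rintro rfl
  obtain ⟨-, ⟨x, -, y, -, -, he⟩, -⟩ := ht
  have := Finset.card_le_two (a := x) (b := y)
  rw [← he, Finset.sdiff_empty] at this
  omega

end Game

/-! ### Attaching a claw -/

section Claw

variable {V : Type} {G : SimpleGraph V} {s t : Finset V} {c a b₁ b₂ : V}

/-- Outside of `s`, the vertex `a` adjacent to `c` and its two leaves `b₁`, `b₂` form a claw which
is joined to `s` by the edge from `c` to `a` only. -/
structure IsPendantClaw (G : SimpleGraph V) (s : Finset V) (c a b₁ b₂ : V) : Prop where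
  notMem_a : a ∉ s
  notMem_b₁ : b₁ ∉ s
  notMem_b₂ : b₂ ∉ s
  ne : b₁ ≠ b₂
  adj_ca : G.Adj c a
  adj_ab₁ : G.Adj a b₁
  adj_ab₂ : G.Adj a b₂
  not_adj : ¬ G.Adj b₁ b₂
  eq_of_adj : ∀ v ∈ s, G.Adj v a → v = c
  not_adj_b₁ : ∀ v ∈ s, ¬ G.Adj v b₁
  not_adj_b₂ : ∀ v ∈ s, ¬ G.Adj v b₂

theorem IsPendantClaw.mono (h : IsPendantClaw G s c a b₁ b₂) (hts : t ⊆ s) :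
    IsPendantClaw G t c a b₁ b₂ where
  notMem_a := fun hv => h.notMem_a (hts hv)
  notMem_b₁ := fun hv => h.notMem_b₁ (hts hv)
  notMem_b₂ := fun hv => h.notMem_b₂ (hts hv)
  ne := h.ne
  adj_ca := h.adj_ca
  adj_ab₁ := h.adj_ab₁
  adj_ab₂ := h.adj_ab₂
  not_adj := h.not_adj
  eq_of_adj := fun v hv => h.eq_of_adj v (hts hv)
  not_adj_b₁ := fun v hv => h.not_adj_b₁ v (hts hv)
  not_adj_b₂ := fun v hv => h.not_adj_b₂ v (hts hv)

theorem IsPendantClaw.symm (h : IsPendantClaw G s c a b₁ b₂) :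
    IsPendantClaw G s c a b₂ b₁ where
  notMem_a := h.notMem_a
  notMem_b₁ := h.notMem_b₂
  notMem_b₂ := h.notMem_b₁
  ne := h.ne.symm
  adj_ca := h.adj_ca
  adj_ab₁ := h.adj_ab₂
  adj_ab₂ := h.adj_ab₁
  not_adj := fun hadj => h.not_adj hadj.symm
  eq_of_adj := h.eq_of_adj
  not_adj_b₁ := h.not_adj_b₂
  not_adj_b₂ := h.not_adj_b₁

variable [DecidableEq V]

theorem IsPendantClaw.linked_union_pair (h : IsPendantClaw G s c a b₁ b₂) (hc : c ∈ s)
    (hs : Linked G (s : Set V)) : Linked G ((s ∪ {a, b₁} : Finset V) : Set V) := by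
  have := (hs.insert (Finset.mem_coe.mpr hc) h.adj_ca).insert (Set.mem_insert _ _) h.adj_ab₁
  convert this using 1
  ext v
  simp
  tauto

theorem IsPendantClaw.linked_union (h : IsPendantClaw G s c a b₁ b₂) (hc : c ∈ s)
    (hs : Linked G (s : Set V)) : Linked G ((s ∪ {a, b₁, b₂} : Finset V) : Set V) := by
  have := (h.linked_union_pair hc hs).insert (x := b₂) (y := a) (by simp) h.adj_ab₂
  convert this using 1
  ext v
  simp
  tauto

theorem IsPendantClaw.linked_claw (h : IsPendantClaw G s c a b₁ b₂) :
    Linked G (({a, b₁, b₂} : Finset V) : Set V) := by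
  have := ((linked_singleton G a).insert (by simp) h.adj_ab₁).insert (x := b₂) (y := a)
    (by simp) h.adj_ab₂
  convert this using 1
  ext v
  simp
  tauto

theorem IsPendantClaw.grundy_claw (h : IsPendantClaw G s c a b₁ b₂) :
    grundy G {a, b₁, b₂} = 0 := by
  refine grundy_eq_zero_of_card_eq_three h.linked_claw ?_
  rw [Finset.card_eq_three]
  exact ⟨a, b₁, b₂, h.adj_ab₁.ne, h.adj_ab₂.ne, h.ne, rfl⟩

theorem IsPendantClaw.disjoint (h : IsPendantClaw G s c a b₁ b₂) :
    Disjoint s {a, b₁, b₂} := by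
  simp [Finset.disjoint_insert_right, h.notMem_a, h.notMem_b₁, h.notMem_b₂]

theorem IsPendantClaw.union_sdiff_union (h : IsPendantClaw G s c a b₁ b₂) (t : Finset V) :
    (s ∪ {a, b₁, b₂}) \ (t ∪ {a, b₁, b₂}) = s \ t := by
  ext v
  have := fun hv : v ∈ s => Finset.disjoint_left.mp h.disjoint hv
  simp only [Finset.mem_sdiff, Finset.mem_union]
  tauto

theorem IsPendantClaw.linkedMove_union (h : IsPendantClaw G s c a b₁ b₂)
    (ht : LinkedMove G s t) (hct : c ∈ t) :
    LinkedMove G (s ∪ {a, b₁, b₂}) (t ∪ {a, b₁, b₂}) := by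
  obtain ⟨hts, ⟨x, hx, y, hy, hxy, he⟩, hl⟩ := ht
  refine ⟨Finset.union_subset_union_left hts, ⟨x, Finset.mem_union_left _ hx, y,
    Finset.mem_union_left _ hy, hxy, ?_⟩, (h.mono hts).linked_union hct hl⟩
  rw [h.union_sdiff_union, he]

theorem IsPendantClaw.linkedMove_claw (h : IsPendantClaw G s c a b₁ b₂)
    (ht : LinkedMove G s ∅) : LinkedMove G (s ∪ {a, b₁, b₂}) {a, b₁, b₂} := by
  obtain ⟨-, ⟨x, hx, y, hy, hxy, he⟩, -⟩ := ht
  refine ⟨Finset.subset_union_right, ⟨x, Finset.mem_union_left _ hx, y,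
    Finset.mem_union_left _ hy, hxy, ?_⟩, h.linked_claw⟩
  have := h.union_sdiff_union ∅
  rw [Finset.empty_union] at this
  rw [this, he]

theorem IsPendantClaw.grundy_union_pair_ne (h : IsPendantClaw G s c a b₁ b₂) (hc : c ∈ s)
    (hs : Linked G (s : Set V)) : grundy G (s ∪ {a, b₁}) ≠ grundy G s := by
  refine (grundy_ne_of_validMove ((validMove_iff (h.linked_union_pair hc hs)).mpr
    ⟨Finset.subset_union_left, ⟨a, by simp, b₁, by simp, .inr h.adj_ab₁, ?_⟩, hs⟩)).symm
  rw [Finset.union_sdiff_left, Finset.sdiff_eq_self_iff_disjoint]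
  simp [Finset.disjoint_insert_left, h.notMem_a, h.notMem_b₁]

theorem IsPendantClaw.linked_of_linked_union (h : IsPendantClaw G s c a b₁ b₂)
    (hs : Linked G ((s ∪ {a, b₁, b₂} : Finset V) : Set V)) : Linked G (s : Set V) := by
  rintro U ⟨x, hx, hxU⟩ hU y hy
  have hd := Finset.disjoint_left.mp h.disjoint
  have := hs {v | (v ∈ s ∧ v ∈ U) ∨ (v ∉ s ∧ c ∈ U)}
    ⟨x, Finset.mem_union_left _ hx, .inl ⟨hx, hxU⟩⟩ (by
      have hcross : ∀ u ∈ s, ∀ v ∈ ({a, b₁, b₂} : Finset V), G.Adj u v → u = c := by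
        intro u hu v hv huv
        simp only [Finset.mem_insert, Finset.mem_singleton] at hv
        rcases hv with rfl | rfl | rfl
        · exact h.eq_of_adj u hu huv
        · exact absurd huv (h.not_adj_b₁ u hu)
        · exact absurd huv (h.not_adj_b₂ u hu)
      rintro u hu huU v hv huv
      rcases Finset.mem_union.mp (Finset.mem_coe.mp hu) with hu | hu <;>
        rcases Finset.mem_union.mp (Finset.mem_coe.mp hv) with hv | hv
      · exact .inl ⟨hv, hU u hu (huU.resolve_right fun h => h.1 hu).2 v hv huv⟩
      · have huU := (huU.resolve_right fun h => h.1 hu).2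
        exact .inr ⟨fun hvs => hd hvs hv, hcross u hu v hv huv ▸ huU⟩
      · have hcU := (huU.resolve_left fun h => hd h.1 hu).2
        exact .inl ⟨hv, (hcross v hv u hu huv.symm).symm ▸ hcU⟩
      · exact .inr ⟨fun hvs => hd hvs hv, (huU.resolve_left fun h => hd h.1 hu).2⟩)
  rcases this (Finset.mem_union_left _ hy) with h | h
  · exact h.2
  · exact absurd hy h.1

theorem IsPendantClaw.eq_of_notMem (h : IsPendantClaw G s c a b₁ b₂)
    (ht : LinkedMove G (s ∪ {a, b₁, b₂}) t) (hat : a ∈ t) (hbt : b₁ ∉ t) :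
    t = s ∪ {a, b₂} := by
  have key : ∀ v ∈ s ∪ {a, b₁, b₂}, v ∉ t → v = b₁ := by
    intro v hv hvt
    rcases ht.eq_or_adj hv hvt (by simp) hbt with he | hadj
    · exact he
    · simp only [Finset.mem_union, Finset.mem_insert, Finset.mem_singleton] at hv
      rcases hv with hv | rfl | rfl | rfl
      · exact absurd hadj (h.not_adj_b₁ v hv)
      · exact absurd hat hvt
      · rfl
      · exact absurd hadj.symm h.not_adj
  ext v
  have h1 := key v
  have h2 := fun hv : v ∈ t => ht.1 hv
  have h3 := h.notMem_b₁
  have h4 := h.ne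
  have h5 := h.adj_ab₁.ne
  simp only [Finset.mem_union, Finset.mem_insert, Finset.mem_singleton] at *
  constructor
  · intro hv
    rcases h2 hv with h | h | rfl | h
    · exact .inl h
    · exact .inr (.inl h)
    · exact absurd hv hbt
    · exact .inr (.inr h)
  · intro hv
    by_contra hvt
    obtain rfl : v = b₁ := h1 (by tauto) hvt
    rcases hv with hv | hv | hv
    · exact h3 hv
    · exact h5 hv.symm
    · exact h4 hv

/-- A leaf of the claw cannot stay while its neighbour is removed, unless nothing else stays. -/
theorem IsPendantClaw.eq_of_linked (h : IsPendantClaw G s c a b₁ b₂)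
    (hts : t ⊆ s ∪ {a, b₁, b₂}) (ht : Linked G (t : Set V)) (hat : a ∉ t) (hbt : b₁ ∈ t)
    {v : V} (hv : v ∈ t) : v = b₁ := by
  refine ht {b₁} ⟨b₁, hbt, rfl⟩ ?_ hv
  rintro u - rfl w hw huw
  have hws := hts hw
  simp only [Finset.mem_union, Finset.mem_insert, Finset.mem_singleton] at hws
  rcases hws with hws | rfl | rfl | rfl
  · exact absurd huw.symm (h.not_adj_b₁ w hws)
  · exact absurd hw hat
  · rfl
  · exact absurd huw h.not_adj

theorem IsPendantClaw.linkedMove_cases (h : IsPendantClaw G s c a b₁ b₂) (hc : c ∈ s)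
    (ht : LinkedMove G (s ∪ {a, b₁, b₂}) t) :
    (∃ r, LinkedMove G s r ∧ c ∈ r ∧ t = r ∪ {a, b₁, b₂}) ∨
      (LinkedMove G s ∅ ∧ t = {a, b₁, b₂}) ∨ t = s ∪ {a, b₁} ∨ t = s ∪ {a, b₂} := by
  have hcA := Finset.disjoint_left.mp h.disjoint hc
  simp only [Finset.mem_insert, Finset.mem_singleton, not_or] at hcA
  have hswap : s ∪ {a, b₁, b₂} = s ∪ {a, b₂, b₁} := by rw [Finset.pair_comm b₁ b₂]
  have hat : a ∈ t := by
    by_contra hat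
    by_cases hb₁ : b₁ ∈ t
    · have hall := fun v hv => h.eq_of_linked ht.1 ht.2.2 hat hb₁ (v := v) hv
      have hct : c ∉ t := fun hct => hcA.2.1 (hall c hct)
      have hb₂ : b₂ ∉ t := fun hb => h.ne (hall b₂ hb).symm
      rcases ht.eq_or_adj (Finset.mem_union_left _ hc) hct (v := b₂) (by simp) hb₂ with he | he
      · exact hcA.2.2 he
      · exact h.not_adj_b₂ c hc he
    · by_cases hb₂ : b₂ ∈ t
      · have hall := fun v hv => h.symm.eq_of_linked (hswap ▸ ht.1) ht.2.2 hat hb₂ (v := v) hv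
        have hct : c ∉ t := fun hct => hcA.2.2 (hall c hct)
        rcases ht.eq_or_adj (Finset.mem_union_left _ hc) hct (v := b₁) (by simp) hb₁ with he | he
        · exact hcA.2.1 he
        · exact h.not_adj_b₁ c hc he
      · rcases ht.eq_or_adj (u := b₁) (by simp) hb₁ (v := b₂) (by simp) hb₂ with he | he
        · exact h.ne he
        · exact h.not_adj he
  by_cases hb₁ : b₁ ∈ t
  swap
  · exact .inr (.inr (.inr (h.eq_of_notMem ht hat hb₁)))
  by_cases hb₂ : b₂ ∈ t
  swap
  · exact .inr (.inr (.inl (h.symm.eq_of_notMem (hswap ▸ ht) hat hb₂)))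
  have hclaw : {a, b₁, b₂} ⊆ t := by simp [Finset.insert_subset_iff, hat, hb₁, hb₂]
  have htr : t = (t ∩ s) ∪ {a, b₁, b₂} := by
    ext v
    have h1 := fun hv : v ∈ t => ht.1 hv
    have h2 := @hclaw v
    simp only [Finset.mem_union, Finset.mem_inter] at *
    tauto
  obtain ⟨hts, ⟨x, hx, y, hy, hxy, he⟩, hl⟩ := ht
  have hrem : s \ (t ∩ s) = {x, y} := by
    rw [← he]
    conv_rhs => rw [htr]
    rw [h.union_sdiff_union]
  have hxs : x ∈ s := (Finset.mem_sdiff.mp (hrem ▸ Finset.mem_insert_self x _ : x ∈ s \ (t ∩ s))).1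
  have hys : y ∈ s := (Finset.mem_sdiff.mp
    (hrem ▸ Finset.mem_insert_of_mem (Finset.mem_singleton_self y) : y ∈ s \ (t ∩ s))).1
  by_cases hct : c ∈ t
  · refine .inl ⟨t ∩ s, ⟨Finset.inter_subset_right, ⟨x, hxs, y, hys, hxy, hrem⟩, ?_⟩,
      Finset.mem_inter.mpr ⟨hct, hc⟩, htr⟩
    refine (h.mono Finset.inter_subset_right).linked_of_linked_union ?_
    rwa [← htr]
  · have hr : t ∩ s = ∅ := by
      rw [Finset.eq_empty_iff_forall_notMem]
      intro v hv
      obtain ⟨hvt, hvs⟩ := Finset.mem_inter.mp hv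
      have := hl {v | v ∉ s} ⟨a, hat, h.notMem_a⟩ (by
        rintro u hu hus w hw huw hws
        have huA := hts hu
        simp only [Finset.mem_union, Finset.mem_insert, Finset.mem_singleton] at huA
        rcases huA with huA | rfl | rfl | rfl
        · exact hus huA
        · exact hct (h.eq_of_adj w hws huw.symm ▸ hw)
        · exact h.not_adj_b₁ w hws huw.symm
        · exact h.not_adj_b₂ w hws huw.symm)
      exact this hvt hvs
    rw [hr] at hrem htr
    exact .inr (.inl ⟨⟨Finset.empty_subset _, ⟨x, hxs, y, hys, hxy, hrem⟩,
      by simpa using linked_empty G⟩, by simpa using htr⟩)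

/-- Joining `c` to the center of a claw does not change the Grundy value, provided that, in all
positions containing `c`, the moves removing `c` can be dispensed with. -/
theorem IsPendantClaw.grundy_union (h : IsPendantClaw G s c a b₁ b₂) (hc : c ∈ s)
    (hs : Linked G (s : Set V))
    (hdisp : ∀ r ⊆ s, c ∈ r → Linked G (r : Set V) → ∀ t, LinkedMove G r t → c ∉ t →
      t.Nonempty → r.card = 3 ∨ ∃ u, LinkedMove G r u ∧ c ∈ u ∧ grundy G u = grundy G t) :
    grundy G (s ∪ {a, b₁, b₂}) = grundy G s := by
  induction hn : s.card using Nat.strong_induction_on generalizing s with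
  | _ n ih =>
  have hval : ∀ t, LinkedMove G s t → c ∈ t → grundy G (t ∪ {a, b₁, b₂}) = grundy G t :=
    fun t ht hct => ih _ (hn ▸ ht.card_lt) (h.mono ht.1) hct ht.2.2
      (fun r hr => hdisp r (hr.trans ht.1)) rfl
  have hne : ∀ t, LinkedMove G s t → grundy G t ≠ grundy G s := fun t ht =>
    grundy_ne_of_validMove ((validMove_iff hs).mpr ht)
  have hs' := h.linked_union hc hs
  refine grundy_eq_of (fun t ht => ?_) (fun m hm => ?_)
  · rcases h.linkedMove_cases hc ((validMove_iff hs').mp ht) with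
      ⟨r, hr, hcr, rfl⟩ | ⟨hr, rfl⟩ | rfl | rfl
    · rw [hval r hr hcr]
      exact hne r hr
    · rw [h.grundy_claw, ← grundy_empty G]
      exact hne _ hr
    · exact h.grundy_union_pair_ne hc hs
    · exact h.symm.grundy_union_pair_ne hc hs
  · obtain ⟨t, ht, rfl⟩ := exists_validMove_of_lt_grundy hm
    have ht := (validMove_iff hs).mp ht
    simp only [validMove_iff hs']
    by_cases hct : c ∈ t
    · exact ⟨_, h.linkedMove_union ht hct, hval t ht hct⟩
    rcases t.eq_empty_or_nonempty with rfl | htne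
    · exact ⟨_, h.linkedMove_claw ht, by rw [h.grundy_claw, grundy_empty]⟩
    rcases hdisp s subset_rfl hc hs t ht hct htne with h3 | ⟨u, hu, hcu, he⟩
    · rw [grundy_eq_zero_of_card_eq_three hs h3] at hm
      omega
    · exact ⟨_, h.linkedMove_union hu hcu, (hval u hu hcu).trans he⟩

end Claw

/-! ### Paths -/

theorem pathG_adj {i j : ℕ} : pathG.Adj i j ↔ j = i + 1 ∨ i = j + 1 := by
  simp only [pathG, SimpleGraph.fromRel_adj]
  omega

theorem linked_pathG_Ico (k n : ℕ) : Linked pathG ((Finset.Ico k n : Finset ℕ) : Set ℕ) := by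
  rintro U ⟨x, hx, hxU⟩ hU y hy
  simp only [Finset.coe_Ico, Set.mem_Ico] at *
  rcases le_total x y with hxy | hyx
  · induction y, hxy using Nat.le_induction with
    | base => exact hxU
    | succ y hxy ih =>
      exact hU y (by omega) (ih (by omega)) _ hy (pathG_adj.mpr (.inl rfl))
  · induction x, hyx using Nat.le_induction with
    | base => exact hxU
    | succ x hyx ih =>
      exact ih (hU (x + 1) hx hxU x ⟨by omega, by omega⟩ (pathG_adj.mpr (.inr rfl)))
        ⟨by omega, by omega⟩

section Path

variable {V : Type} [DecidableEq V] {G : SimpleGraph V} {f : ℕ → V}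

theorem linked_image_Ico (hf : f.Injective) (hadj : ∀ i j, pathG.Adj i j ↔ G.Adj (f i) (f j))
    (k n : ℕ) : Linked G (((Finset.Ico k n).image f : Finset V) : Set V) := by
  rw [Finset.coe_image]
  exact (linked_image_iff hf.injOn fun i _ j _ => hadj i j).mpr (linked_pathG_Ico k n)

theorem grundy_image_Ico (hf : f.Injective) (hadj : ∀ i j, pathG.Adj i j ↔ G.Adj (f i) (f j))
    (k n : ℕ) : grundy G ((Finset.Ico k n).image f) = grundy pathG (Finset.range (n - k)) := by
  rw [grundy_image (linked_pathG_Ico k n) hf.injOn fun i _ j _ => hadj i j]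
  have : Finset.Ico k n = (Finset.Ico 0 (n - k)).image (k + ·) := by
    ext i
    simp only [Finset.mem_Ico, Finset.mem_image]
    exact ⟨fun hi => ⟨i - k, by omega⟩, fun ⟨j, hj⟩ => by omega⟩
  rw [this, grundy_image (linked_pathG_Ico 0 (n - k)) (add_right_injective k).injOn
    (fun i _ j _ => by rw [pathG_adj, pathG_adj]; omega), Finset.range_eq_Ico]

theorem exists_eq_image_range {s : Finset V} (hf : f.Injective) (hs : ∀ v ∈ s, ∃ i, f i = v)
    (hdown : ∀ i, f (i + 1) ∈ s → f i ∈ s) : ∃ n, s = (Finset.range n).image f := by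
  have hex : ∃ n, f n ∉ s := by
    by_contra! hall
    exact Set.infinite_range_of_injective hf
      (s.finite_toSet.subset (Set.range_subset_iff.mpr hall))
  classical
  refine ⟨Nat.find hex, ?_⟩
  have hmono : ∀ i j, i ≤ j → f j ∈ s → f i ∈ s := fun i j hij => by
    induction j, hij using Nat.le_induction with
    | base => exact id
    | succ j _ ih => exact fun hj => ih (hdown j hj)
  ext v
  simp only [Finset.mem_image, Finset.mem_range]
  constructor
  · intro hv
    obtain ⟨i, rfl⟩ := hs v hv
    exact ⟨i, not_le.mp fun hle => Nat.find_spec hex (hmono _ _ hle hv), rfl⟩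
  · rintro ⟨i, hi, rfl⟩
    exact not_not.mp (Nat.find_min hex hi)

/-- Removing the first `k ≤ 2` vertices of a path is equivalent to removing the last `k`. -/
theorem exists_reflected_move {s t : Finset V} {k : ℕ} (hf : f.Injective)
    (hadj : ∀ i j, pathG.Adj i j ↔ G.Adj (f i) (f j)) (hs : ∀ v ∈ s, ∃ i, f i = v)
    (hdown : ∀ i, f (i + 1) ∈ s → f i ∈ s) (hts : t ⊆ s) (htne : t.Nonempty)
    (hk : k = 1 ∨ k = 2) (hrem : s \ t = (Finset.range k).image f) :
    s.card = k + t.card ∧ LinkedMove G s ((Finset.range t.card).image f) ∧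
      grundy G ((Finset.range t.card).image f) = grundy G t := by
  obtain ⟨n, rfl⟩ := exists_eq_image_range hf hs hdown
  have hmem : ∀ i m, f i ∈ (Finset.range m).image f ↔ i < m := fun i m => by
    rw [hf.mem_finset_image, Finset.mem_range]
  have hcard : n = k + t.card := by
    have := Finset.card_sdiff_add_card_eq_card hts
    rw [hrem, Finset.card_image_of_injective _ hf, Finset.card_image_of_injective _ hf,
      Finset.card_range, Finset.card_range] at this
    exact this.symm
  have htpos := htne.card_pos
  have ht : t = (Finset.Ico k n).image f := by
    rw [← Finset.sdiff_sdiff_eq_self hts, hrem, ← Finset.image_sdiff _ _ hf]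
    congr 1
    ext i
    simp
    omega
  refine ⟨by rw [Finset.card_image_of_injective _ hf, Finset.card_range, hcard],
    ⟨Finset.image_subset_image (Finset.range_mono (by omega)),
      ⟨f t.card, (hmem _ _).mpr (by omega), f (n - 1), (hmem _ _).mpr (by omega), ?_, ?_⟩,
      by simpa only [Finset.range_eq_Ico] using linked_image_Ico hf hadj 0 t.card⟩, ?_⟩
  · rcases hk with rfl | rfl
    · exact .inl (congrArg f (by omega))
    · exact .inr ((hadj _ _).mp (pathG_adj.mpr (by omega)))
  · rw [← Finset.image_sdiff _ _ hf, ← Finset.image_singleton, ← Finset.image_insert]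
    congr 1
    ext i
    simp
    omega
  · have h1 := grundy_image_Ico hf hadj 0 t.card
    have h2 := grundy_image_Ico hf hadj k n
    rw [← Finset.range_eq_Ico, Nat.sub_zero] at h1
    rw [← ht, show n - k = t.card by omega] at h2
    rw [h1, h2]

end Path

/-! ### Subdivided stars -/

/-- `v` is the center `(0, 0)` or may lie on an arm of the first subdivided star in the encoding
of subdivided bistars. -/
def IsStarVertex (v : ℕ × ℕ) : Prop :=
  (v.1 = 0 ∧ v.2 = 0) ∨ (2 ≤ v.1 ∧ v.1 % 2 = 0 ∧ 1 ≤ v.2)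

theorem bistarG_adj_iff {m : ℕ} {u v : ℕ × ℕ} (hu : IsStarVertex u) (hv : IsStarVertex v) :
    (bistarG m).Adj u v ↔ (u.1 = 0 ∧ v.1 ≠ 0 ∧ v.2 = 1) ∨ (v.1 = 0 ∧ u.1 ≠ 0 ∧ u.2 = 1) ∨
      (u.1 ≠ 0 ∧ u.1 = v.1 ∧ (v.2 = u.2 + 1 ∨ u.2 = v.2 + 1)) := by
  obtain ⟨u₁, u₂⟩ := u
  obtain ⟨v₁, v₂⟩ := v
  simp only [IsStarVertex] at hu hv
  simp only [bistarG, SimpleGraph.fromRel_adj, ne_eq]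
  have hu2 : u₁ % 2 ≠ 1 := by omega
  have hv2 : v₁ % 2 ≠ 1 := by omega
  simp only [hu2, hv2, false_and, and_false, false_or, Prod.mk.injEq]
  rcases hu with ⟨rfl, rfl⟩ | hu <;> rcases hv with ⟨rfl, rfl⟩ | hv <;> omega

theorem Linked.mem_of_succ_mem {m : ℕ} {s : Finset (ℕ × ℕ)}
    (hs : Linked (bistarG m) (s : Set (ℕ × ℕ))) (hstar : ∀ v ∈ s, IsStarVertex v)
    (hc : (0, 0) ∈ s) {i j : ℕ} (hj : 1 ≤ j) (h : (i, j + 1) ∈ s) : (i, j) ∈ s := by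
  by_contra hn
  have := hs {v | v.1 = i ∧ j < v.2} ⟨_, h, rfl, Nat.lt_succ_self j⟩ (by
    rintro u hu ⟨rfl, hju⟩ v hv huv
    rw [bistarG_adj_iff (hstar u hu) (hstar v hv)] at huv
    have hne : v.1 = u.1 → v.2 ≠ j := by
      rintro h1 rfl
      exact hn (h1 ▸ hv)
    have := hstar u hu
    unfold IsStarVertex at this
    simp only [Set.mem_ofPred_eq]
    omega)
  exact absurd (this hc).2 (Nat.not_lt_zero j)

theorem linked_of_forall_mem {m : ℕ} {s : Finset (ℕ × ℕ)} (hstar : ∀ v ∈ s, IsStarVertex v)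
    (hc : (0, 0) ∈ s) (hdown : ∀ i j, 1 ≤ j → (i, j + 1) ∈ s → (i, j) ∈ s) :
    Linked (bistarG m) (s : Set (ℕ × ℕ)) := by
  rintro U ⟨⟨i, j⟩, hx, hxU⟩ hU
  have hcenter : ∀ i, (i, 1) ∈ s → (bistarG m).Adj (0, 0) (i, 1) := fun i hi => by
    have := hstar _ hi
    rw [bistarG_adj_iff (hstar _ hc) this]
    exact .inl ⟨rfl, by unfold IsStarVertex at this; omega, rfl⟩
  have hstep : ∀ i j, 1 ≤ j → (i, j + 1) ∈ s → (bistarG m).Adj (i, j) (i, j + 1) :=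
    fun i j hj hi => by
      have := hstar _ hi
      rw [bistarG_adj_iff (hstar _ (hdown i j hj hi)) this]
      exact .inr (.inr ⟨by unfold IsStarVertex at this; omega, rfl, .inl rfl⟩)
  have hzero : ∀ i, (i, 0) ∈ s → i = 0 := fun i hi => by
    have := hstar _ hi
    unfold IsStarVertex at this
    simp only at this
    omega
  have hcU : (0, 0) ∈ U := by
    induction j with
    | zero => exact hzero i hx ▸ hxU
    | succ j ih =>
      rcases Nat.eq_zero_or_pos j with rfl | hj
      · exact hU _ hx hxU _ hc (hcenter i hx).symm
      · exact ih (hdown i j hj hx) (hU _ hx hxU _ (hdown i j hj hx) (hstep i j hj hx).symm)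
  rintro ⟨p, q⟩ hy
  induction q with
  | zero => exact hzero p hy ▸ hcU
  | succ q ih =>
    rcases Nat.eq_zero_or_pos q with rfl | hq
    · exact hU _ hc hcU _ hy (hcenter p hy)
    · exact hU _ (hdown p q hq hy) (ih (hdown p q hq hy)) _ hy (hstep p q hq hy)

/-- The vertex `j` of the path made of the center followed by the arm `i`. -/
def armPath (i j : ℕ) : ℕ × ℕ := (if j = 0 then 0 else i, j)

/-- The vertex `j` of the path made of the first vertex of the arm `p`, the center,
and the arm `i`. -/
def twoArmPath (p i j : ℕ) : ℕ × ℕ :=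
  if j = 0 then (p, 1) else (if j = 1 then 0 else i, j - 1)

theorem armPath_injective (i : ℕ) : (armPath i).Injective :=
  fun _ _ h => congrArg Prod.snd h

theorem armPath_adj {m i : ℕ} (hi : 2 ≤ i) (hi2 : i % 2 = 0) (j k : ℕ) :
    pathG.Adj j k ↔ (bistarG m).Adj (armPath i j) (armPath i k) := by
  have hstar : ∀ j, IsStarVertex (armPath i j) := fun j => by
    unfold IsStarVertex armPath
    grind
  rw [bistarG_adj_iff (hstar j) (hstar k), pathG_adj]
  unfold armPath
  grind

theorem twoArmPath_injective {p i : ℕ} (hpi : p ≠ i) :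
    (twoArmPath p i).Injective := by
  intro j k h
  unfold twoArmPath at h
  grind

theorem twoArmPath_adj {m p i : ℕ} (hp : 2 ≤ p) (hp2 : p % 2 = 0) (hi : 2 ≤ i) (hi2 : i % 2 = 0)
    (hpi : p ≠ i) (j k : ℕ) :
    pathG.Adj j k ↔ (bistarG m).Adj (twoArmPath p i j) (twoArmPath p i k) := by
  have hstar : ∀ j, IsStarVertex (twoArmPath p i j) := fun j => by
    unfold IsStarVertex twoArmPath
    grind
  rw [bistarG_adj_iff (hstar j) (hstar k), pathG_adj]
  unfold twoArmPath
  grind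

/-- A move removing the center of a subdivided star leaves a path, and can be replaced by
a move keeping the center unless the star has three vertices. -/
theorem exists_move_keeping_center {m : ℕ} {s t : Finset (ℕ × ℕ)}
    (hs : Linked (bistarG m) (s : Set (ℕ × ℕ))) (hstar : ∀ v ∈ s, IsStarVertex v)
    (hc : (0, 0) ∈ s) (ht : LinkedMove (bistarG m) s t) (hct : (0, 0) ∉ t) (htne : t.Nonempty) :
    s.card = 3 ∨ ∃ u, LinkedMove (bistarG m) s u ∧ (0, 0) ∈ u ∧
      grundy (bistarG m) u = grundy (bistarG m) t := by
  have hdown : ∀ i j, 1 ≤ j → (i, j + 1) ∈ s → (i, j) ∈ s :=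
    fun i j => hs.mem_of_succ_mem hstar hc
  obtain ⟨hts, ⟨x, hx, y, hy, hxy, hrem⟩, hl⟩ := ht
  obtain ⟨p, hp, hadj, hrem⟩ : ∃ p ∈ s, ((0, 0) = p ∨ (bistarG m).Adj (0, 0) p) ∧
      s \ t = {(0, 0), p} := by
    have hmem : ((0, 0) : ℕ × ℕ) ∈ s \ t := Finset.mem_sdiff.mpr ⟨hc, hct⟩
    simp only [hrem, Finset.mem_insert, Finset.mem_singleton] at hmem
    rcases hmem with rfl | rfl
    · exact ⟨y, hy, hxy, hrem⟩
    · exact ⟨x, hx, hxy.imp Eq.symm SimpleGraph.Adj.symm, by rw [hrem, Finset.pair_comm]⟩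
  obtain ⟨⟨i, j⟩, hij⟩ := htne
  have hpos : ∀ v ∈ t, 2 ≤ v.1 ∧ v.1 % 2 = 0 ∧ 1 ≤ v.2 := by
    intro v hv
    rcases hstar v (hts hv) with ⟨h1, h2⟩ | h
    · exact absurd (Prod.ext h1 h2 : v = (0, 0)) (fun h => hct (h ▸ hv))
    · exact h
  obtain ⟨hi, hi2, -⟩ := hpos _ hij
  simp only at hi hi2
  have harm : ∀ v ∈ t, v.1 = i := fun v hv => hl {v | v.1 = i} ⟨_, hij, rfl⟩ (by
    intro u hu hui w hw huw
    rw [bistarG_adj_iff (hstar u (hts hu)) (hstar w (hts hw))] at huw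
    have := hpos u hu
    have := hpos w hw
    simp only [Set.mem_ofPred_eq] at *
    omega) hv
  have hcases : ∀ v ∈ s, v = (0, 0) ∨ v = p ∨ (v = (i, v.2) ∧ 1 ≤ v.2) := by
    intro v hv
    by_cases hvt : v ∈ t
    · exact .inr (.inr ⟨Prod.ext (harm v hvt) rfl, (hpos v hvt).2.2⟩)
    · have hmem := Finset.mem_sdiff.mpr ⟨hv, hvt⟩
      simp only [hrem, Finset.mem_insert, Finset.mem_singleton] at hmem
      tauto
  have hp1 : p = (0, 0) ∨ (2 ≤ p.1 ∧ p.1 % 2 = 0 ∧ p = (p.1, 1)) := by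
    rcases hadj with h | h
    · exact .inl h.symm
    · rw [bistarG_adj_iff (hstar _ hc) (hstar _ hp)] at h
      have := hstar _ hp
      unfold IsStarVertex at this
      simp only at h
      exact .inr ⟨by omega, by omega, Prod.ext rfl (by simp only; omega)⟩
  by_cases hpi : p = (0, 0) ∨ p.1 = i
  · have hpath : ∀ v ∈ s, ∃ j, armPath i j = v := by
      intro v hv
      refine ⟨v.2, ?_⟩
      unfold armPath
      rcases hcases v hv with rfl | rfl | ⟨h1, h2⟩
      · rfl
      · grind
      · grind
    have hdown' : ∀ j, armPath i (j + 1) ∈ s → armPath i j ∈ s := by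
      intro j hj
      rcases Nat.eq_zero_or_pos j with rfl | hj0
      · exact hc
      · have := hdown i j hj0
        unfold armPath at *
        grind
    obtain ⟨k, hk, hremk⟩ : ∃ k, (k = 1 ∨ k = 2) ∧
        s \ t = (Finset.range k).image (armPath i) := by
      rcases hp1 with rfl | ⟨h2, -, hp1⟩
      · exact ⟨1, .inl rfl, by rw [hrem]; rfl⟩
      · refine ⟨2, .inr rfl, ?_⟩
        have hpi : p = (i, 1) := by grind
        rw [hrem, hpi, show Finset.range 2 = {0, 1} from rfl, Finset.image_insert,
          Finset.image_singleton]
        rfl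
    obtain ⟨-, hmove, hg⟩ := exists_reflected_move (armPath_injective i) (armPath_adj hi hi2)
      hpath hdown' hts ⟨_, hij⟩ hk hremk
    exact .inr ⟨_, hmove, Finset.mem_image.mpr
      ⟨0, Finset.mem_range.mpr (Finset.card_pos.mpr ⟨_, hij⟩), rfl⟩, hg⟩
  · push Not at hpi
    obtain ⟨hp2, hpe, hp1⟩ := hp1.resolve_left hpi.1
    have hpath : ∀ v ∈ s, ∃ j, twoArmPath p.1 i j = v := by
      intro v hv
      unfold twoArmPath
      rcases hcases v hv with rfl | rfl | ⟨h1, h2⟩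
      · exact ⟨1, rfl⟩
      · exact ⟨0, hp1.symm⟩
      · exact ⟨v.2 + 1, by grind⟩
    have hdown' : ∀ j, twoArmPath p.1 i (j + 1) ∈ s → twoArmPath p.1 i j ∈ s := by
      intro j hj
      match j, hj with
      | 0, _ => exact hp1 ▸ hp
      | 1, _ => exact hc
      | j + 2, hj => exact hdown i (j + 1) (Nat.succ_pos j) hj
    have hremk : s \ t = (Finset.range 2).image (twoArmPath p.1 i) := by
      rw [hrem, show Finset.range 2 = {0, 1} from rfl, Finset.image_insert,
        Finset.image_singleton, Finset.pair_comm]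
      exact congrArg (fun v => ({v, (0, 0)} : Finset (ℕ × ℕ))) hp1
    obtain ⟨hcard, hmove, hg⟩ := exists_reflected_move (twoArmPath_injective hpi.2)
      (twoArmPath_adj hp2 hpe hi hi2 hpi.2) hpath hdown' hts ⟨_, hij⟩ (.inr rfl) hremk
    have htpos : 0 < t.card := Finset.card_pos.mpr ⟨_, hij⟩
    by_cases ht1 : t.card = 1
    · exact .inl (by omega)
    · exact .inr ⟨_, hmove, Finset.mem_image.mpr
        ⟨1, Finset.mem_range.mpr (by omega), rfl⟩, hg⟩

theorem isPendantClaw_bistarG {s : Finset (ℕ × ℕ)} (hstar : ∀ v ∈ s, IsStarVertex v) :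
    IsPendantClaw (bistarG 1) s (0, 0) (1, 1) (3, 1) (5, 1) where
  notMem_a := fun h => by simpa [IsStarVertex] using hstar _ h
  notMem_b₁ := fun h => by simpa [IsStarVertex] using hstar _ h
  notMem_b₂ := fun h => by simpa [IsStarVertex] using hstar _ h
  ne := by simp
  adj_ca := by simp [bistarG]
  adj_ab₁ := by simp [bistarG]
  adj_ab₂ := by simp [bistarG]
  not_adj := by simp [bistarG]
  eq_of_adj := fun v hv h => by
    have := hstar v hv
    unfold IsStarVertex at this
    simp only [bistarG, SimpleGraph.fromRel_adj, Prod.ext_iff] at h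
    refine Prod.ext ?_ ?_ <;> simp at * <;> omega
  not_adj_b₁ := fun v hv h => by
    have := hstar v hv
    unfold IsStarVertex at this
    simp only [bistarG, SimpleGraph.fromRel_adj, Prod.ext_iff] at h
    simp at *
    omega
  not_adj_b₂ := fun v hv h => by
    have := hstar v hv
    unfold IsStarVertex at this
    simp only [bistarG, SimpleGraph.fromRel_adj, Prod.ext_iff] at h
    simp at *
    omega

theorem mem_armVerts {b : ℕ} {L : List ℕ} {v : ℕ × ℕ} :
    v ∈ armVerts b L ↔ ∃ i < L.length, ∃ j < L.getD i 0, (2 * i + b, j + 1) = v := by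
  simp only [armVerts, Finset.mem_biUnion, Finset.mem_range, Finset.mem_image]

/-- For any subdivided star `S`, `𝒢(S) = 𝒢(S •1• S_{1,1})`:
joining the center of `S` by an edge to the center of a disjoint claw `S_{1,1}`
does not change the Grundy value of the 0.33 game. -/
theorem grundy_star_join_claw (L : List ℕ) (hL : armsPos L) :
    starGrundy L = bistarGrundy L [1, 1] 1 := by
  set s : Finset (ℕ × ℕ) := insert (0, 0) (armVerts 2 L) with hs
  have hc : (0, 0) ∈ s := Finset.mem_insert_self _ _
  have hstar : ∀ v ∈ s, IsStarVertex v := by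
    intro v hv
    rcases Finset.mem_insert.mp hv with rfl | hv
    · exact .inl ⟨rfl, rfl⟩
    · obtain ⟨i, -, j, -, rfl⟩ := mem_armVerts.mp hv
      exact .inr ⟨Nat.le_add_left 2 _, by simp, Nat.le_add_left 1 j⟩
  have hdown : ∀ i j, 1 ≤ j → (i, j + 1) ∈ s → (i, j) ∈ s := by
    intro i j hj h
    have := (Finset.mem_insert.mp h).resolve_left (by simp)
    obtain ⟨k, hk, l, hl, he⟩ := mem_armVerts.mp this
    obtain ⟨h1, h2⟩ := Prod.mk.inj he
    exact Finset.mem_insert_of_mem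
      (mem_armVerts.mpr ⟨k, hk, j - 1, by omega, Prod.ext h1 (Nat.sub_add_cancel hj)⟩)
  have hlink : ∀ m, Linked (bistarG m) (s : Set (ℕ × ℕ)) :=
    fun m => linked_of_forall_mem hstar hc hdown
  have h0 : starGrundy L = grundy (bistarG 0) s := by
    have : bistarVerts (some L) (some []) 0 = s := by simp [bistarVerts, armVerts, hs]
    rw [starGrundy, bistarGrundy, bistarGrundyO, this]
  have h1 : bistarGrundy L [1, 1] 1 = grundy (bistarG 1) (s ∪ {(1, 1), (3, 1), (5, 1)}) := rfl
  have h01 := grundy_image (G := bistarG 0) (H := bistarG 1) (φ := id) (hlink 0)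
    Function.injective_id.injOn fun u hu v hv => by
      rw [bistarG_adj_iff (hstar u hu) (hstar v hv)]
      exact (bistarG_adj_iff (hstar u hu) (hstar v hv)).symm
  rw [Finset.image_id] at h01
  rw [h0, h1, ← h01]
  exact ((isPendantClaw_bistarG hstar).grundy_union hc (hlink 1)
    fun r hr hcr hlr t ht hct htne =>
      exists_move_keeping_center hlr (fun v hv => hstar v (hr hv)) hcr ht hct htne).symm
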